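/- arXiv:2601.14316 — 2 statements merged into one kernel-verified Lean document; each statement's English description precedes it below -/
import Mathlib

section
/- There exist nonempty finite types Λ and S, a probability mass function ρ : Λ × S → ℝ≥0 that factorizes as the product of its marginals (i.e., ρ(λ,s) = (Σ_{s'} ρ(λ,s'))·(Σ_{λ'} ρ(λ',s)) for all λ, s, expressing statistical independence of λ and s), and a weight function μ : Λ × S → ℝ≥0 with Z = Σ_{(λ,s)} ρ(λ,s)·μ(λ,s) > 0, such that the normalized reweighted distribution ρ_Bell(λ,s) = ρ(λ,s)·μ(λ,s)/Z does NOT factorize as the product of its marginals. -/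
open Finset

/-- There is a supermeasured model: a probability mass function `ρ` on pairs
(hidden variable, setting) satisfying Statistical Independence (it factorizes as
the product of its marginals), together with a weight `μ` with positive
normalizer, such that the normalized reweighted distribution
`ρ_Bell = ρ·μ / Z` does NOT factorize as the product of its marginals. -/
theorem exists_supermeasured_SI_violation :
    ∃ (nΛ nS : ℕ), 0 < nΛ ∧ 0 < nS ∧
      ∃ (ρ μ : Fin nΛ × Fin nS → NNReal),
        (∑ p : Fin nΛ × Fin nS, ρ p = 1) ∧
        (∀ l : Fin nΛ, ∀ s : Fin nS,
          ρ (l, s) = (∑ s' : Fin nS, ρ (l, s')) * (∑ l' : Fin nΛ, ρ (l', s))) ∧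
        (0 < ∑ p : Fin nΛ × Fin nS, ρ p * μ p) ∧
        ¬ (∀ l : Fin nΛ, ∀ s : Fin nS,
          ρ (l, s) * μ (l, s) / (∑ p : Fin nΛ × Fin nS, ρ p * μ p) =
            (∑ s' : Fin nS, ρ (l, s') * μ (l, s') /
                (∑ p : Fin nΛ × Fin nS, ρ p * μ p)) *
            (∑ l' : Fin nΛ, ρ (l', s) * μ (l', s) /
                (∑ p : Fin nΛ × Fin nS, ρ p * μ p))) := by
  refine ⟨2, 2, two_pos, two_pos, fun _ ↦ 1 / 4, fun p ↦ if p.1 = p.2 then 1 else 0,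
    ?_, ?_, ?_, ?_⟩
  · simp
  · intro l s
    simp only [Fin.sum_univ_two]
    norm_num
  · simp [Fintype.sum_prod_type]
  · intro h
    have h01 := h 0 1
    simp [Fintype.sum_prod_type] at h01
end

section
/- Let (Ω, 𝓕, P) be a probability space and let A₀, A₁, B₀, B₁ : Ω → ℝ be measurable functions with |A_i(ω)| ≤ 1 and |B_j(ω)| ≤ 1 for all ω ∈ Ω and i, j ∈ {0,1}. Then |E[A₀·B₀] + E[A₀·B₁] + E[A₁·B₀] − E[A₁·B₁]| ≤ 2, where E denotes the expectation (integral) with respect to P. -/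
open MeasureTheory

/-- The pointwise CHSH bound for real numbers of modulus at most `1`. -/
theorem abs_chsh_le_two {a₀ a₁ b₀ b₁ : ℝ} (ha₀ : |a₀| ≤ 1) (ha₁ : |a₁| ≤ 1)
    (hb₀ : |b₀| ≤ 1) (hb₁ : |b₁| ≤ 1) :
    |a₀ * b₀ + a₀ * b₁ + a₁ * b₀ - a₁ * b₁| ≤ 2 := by
  calc |a₀ * b₀ + a₀ * b₁ + a₁ * b₀ - a₁ * b₁|
      = |a₀ * (b₀ + b₁) + a₁ * (b₀ - b₁)| := by ring_nf
    _ ≤ |a₀| * |b₀ + b₁| + |a₁| * |b₀ - b₁| := by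
      simpa only [abs_mul] using abs_add_le (a₀ * (b₀ + b₁)) (a₁ * (b₀ - b₁))
    _ ≤ 1 * |b₀ + b₁| + 1 * |b₀ - b₁| := by gcongr
    _ ≤ 2 := by
      rw [abs_le] at hb₀ hb₁
      rcases abs_cases (b₀ + b₁) with h | h <;> rcases abs_cases (b₀ - b₁) with h' | h' <;>
        linarith

/-- The product of two measurable functions of modulus at most `1` is integrable with respect to
a finite measure. -/
theorem integrable_mul_of_abs_le_one {Ω : Type*} [MeasurableSpace Ω] {P : Measure Ω}
    [IsFiniteMeasure P] {f g : Ω → ℝ} (hf : Measurable f) (hg : Measurable g)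
    (hfb : ∀ ω, |f ω| ≤ 1) (hgb : ∀ ω, |g ω| ≤ 1) :
    Integrable (fun ω => f ω * g ω) P := by
  refine Integrable.of_bound (hf.mul hg).aestronglyMeasurable 1 (.of_forall fun ω => ?_)
  rw [norm_mul]
  exact mul_le_one₀ (hfb ω) (norm_nonneg _) (hgb ω)

/-- The CHSH Bell inequality for local hidden-variable models: if `A₀, A₁, B₀, B₁`
are measurable functions on a probability space, bounded in modulus by 1, then
`|E[A₀B₀] + E[A₀B₁] + E[A₁B₀] − E[A₁B₁]| ≤ 2`. -/
theorem chsh_expectation {Ω : Type*} [MeasurableSpace Ω]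
    (P : Measure Ω) [IsProbabilityMeasure P]
    (A₀ A₁ B₀ B₁ : Ω → ℝ)
    (hA₀ : Measurable A₀) (hA₁ : Measurable A₁)
    (hB₀ : Measurable B₀) (hB₁ : Measurable B₁)
    (hA₀b : ∀ ω, |A₀ ω| ≤ 1) (hA₁b : ∀ ω, |A₁ ω| ≤ 1)
    (hB₀b : ∀ ω, |B₀ ω| ≤ 1) (hB₁b : ∀ ω, |B₁ ω| ≤ 1) :
    |(∫ ω, A₀ ω * B₀ ω ∂P) + (∫ ω, A₀ ω * B₁ ω ∂P) +
      (∫ ω, A₁ ω * B₀ ω ∂P) - (∫ ω, A₁ ω * B₁ ω ∂P)| ≤ 2 := by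
  have h₀₀ := integrable_mul_of_abs_le_one (P := P) hA₀ hB₀ hA₀b hB₀b
  have h₀₁ := integrable_mul_of_abs_le_one (P := P) hA₀ hB₁ hA₀b hB₁b
  have h₁₀ := integrable_mul_of_abs_le_one (P := P) hA₁ hB₀ hA₁b hB₀b
  have h₁₁ := integrable_mul_of_abs_le_one (P := P) hA₁ hB₁ hA₁b hB₁b
  rw [← integral_add h₀₀ h₀₁, ← integral_add (h₀₀.fun_add h₀₁) h₁₀,
    ← integral_sub ((h₀₀.fun_add h₀₁).fun_add h₁₀) h₁₁]
  rw [← Real.norm_eq_abs]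
  refine (norm_integral_le_of_norm_le_const (C := 2) (.of_forall fun ω => ?_)).trans_eq ?_
  · exact abs_chsh_le_two (hA₀b ω) (hA₁b ω) (hB₀b ω) (hB₁b ω)
  · simp
end
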